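/- (Constantin–E–Titi-type commutator estimate, spatial version.) Let d≥2, 0<α₁,α₂<1, and 1≤p,q,p₁,q₁,p₂,q₂≤∞ with 1/p = 1/p₁ + 1/p₂ and 1/q = 1/q₁ + 1/q₂. Then there is a constant C such that for every f ∈ L^{p₁}(0,T;Ḃ^{α₁}_{q₁,∞}(𝕋^d)), every g ∈ L^{p₂}(0,T;Ḃ^{α₂}_{q₂,∞}(𝕋^d)) and every ε>0, ‖(fg)^ε − f^ε g^ε‖_{L^p(0,T;L^q(𝕋^d))} ≤ C ε^{α₁+α₂} ‖f‖_{L^{p₁}(0,T;Ḃ^{α₁}_{q₁,∞}(𝕋^d))} ‖g‖_{L^{p₂}(0,T;Ḃ^{α₂}_{q₂,∞}(𝕋^d))}, where f^ε, g^ε, (fg)^ε denote mollification in the space variable only. -/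

import Mathlib

open MeasureTheory ENNReal

noncomputable section

namespace CompressibleEuler

variable {d : ℕ} {E : Type*} [NormedAddCommGroup E]

/-- Euclidean norm on `Fin d → ℝ`. -/
def euNorm (x : Fin d → ℝ) : ℝ := Real.sqrt (∑ i, x i ^ 2)

/-- The fundamental domain `[0,1)^d` of the torus `𝕋^d = [0,1]^d`. -/
def unitCube (d : ℕ) : Set (Fin d → ℝ) := Set.univ.pi fun _ => Set.Ico (0 : ℝ) 1

/-- Lebesgue measure on the torus `𝕋^d`, realized on the fundamental domain. -/
def cubeVol (d : ℕ) : Measure (Fin d → ℝ) := volume.restrict (unitCube d)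

/-- Product measure on `(0,T) × 𝕋^d`. -/
def spaceTime (d : ℕ) (T : ℝ) : Measure (ℝ × (Fin d → ℝ)) :=
  (volume.restrict (Set.Ioo 0 T)).prod (cubeVol d)

/-- `ℤ^d`-periodicity of a function on `ℝ^d` (i.e. a function on the torus `𝕋^d`). -/
def SpacePeriodic (f : (Fin d → ℝ) → E) : Prop :=
  ∀ (x : Fin d → ℝ) (n : Fin d → ℤ), f (x + fun i => (n i : ℝ)) = f x

/-- The `L^p` norm in time (exponent possibly `∞`) of an `ℝ≥0∞`-valued quantity,
over a time set `s`. -/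
def timeLpOn (s : Set ℝ) (p : ℝ≥0∞) (F : ℝ → ℝ≥0∞) : ℝ≥0∞ :=
  if p = ∞ then essSup F (volume.restrict s)
  else (∫⁻ t in s, F t ^ p.toReal) ^ (1 / p.toReal)

/-- The `L^p(0,T;L^q(𝕋^d))` norm. -/
def LpLqNorm (T : ℝ) (p q : ℝ≥0∞) (u : ℝ → (Fin d → ℝ) → E) : ℝ≥0∞ :=
  timeLpOn (Set.Ioo 0 T) p fun t => eLpNorm (u t) q (cubeVol d)

/-- `u ∈ L^p(0,T;L^q(𝕋^d))`. -/
def MemLpLq (T : ℝ) (p q : ℝ≥0∞) (u : ℝ → (Fin d → ℝ) → E) : Prop :=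
  LpLqNorm T p q u < ∞

/-- The homogeneous Besov seminorm `‖·‖_{Ḃ^α_{q,∞}(𝕋^d)}`. -/
def besovSeminorm (α : ℝ) (q : ℝ≥0∞) (f : (Fin d → ℝ) → E) : ℝ≥0∞ :=
  ⨆ (y : Fin d → ℝ) (_ : y ≠ 0),
    eLpNorm (fun x => f (x - y) - f x) q (cubeVol d) / ENNReal.ofReal (euNorm y ^ α)

/-- The Besov norm of `B^α_{q,∞}(𝕋^d)`. -/
def besovNorm (α : ℝ) (q : ℝ≥0∞) (f : (Fin d → ℝ) → E) : ℝ≥0∞ :=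
  eLpNorm f q (cubeVol d) + besovSeminorm α q f

/-- The `L^p(0,T;B^α_{q,∞}(𝕋^d))` norm. -/
def LpBesovNorm (T : ℝ) (p : ℝ≥0∞) (α : ℝ) (q : ℝ≥0∞) (u : ℝ → (Fin d → ℝ) → E) : ℝ≥0∞ :=
  timeLpOn (Set.Ioo 0 T) p fun t => besovNorm α q (u t)

/-- `u ∈ L^p(0,T;B^α_{q,∞}(𝕋^d))`. -/
def MemLpBesov (T : ℝ) (p : ℝ≥0∞) (α : ℝ) (q : ℝ≥0∞) (u : ℝ → (Fin d → ℝ) → E) : Prop :=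
  LpBesovNorm T p α q u < ∞

/-- The norm of the space-time Besov space `B^β_{p,∞}((0,T);B^α_{q,∞}(𝕋^d))`:
the `L^p(0,T;B^α_{q,∞})` norm plus the time-translation seminorm
`sup_{τ≠0} |τ|^{-β} ‖u(·-τ)-u(·)‖_{L^p(B^α_{q,∞})}`, the inner norm being taken
over the times where both terms are defined. -/
def besovBesovNorm (T β : ℝ) (p : ℝ≥0∞) (α : ℝ) (q : ℝ≥0∞)
    (u : ℝ → (Fin d → ℝ) → E) : ℝ≥0∞ :=
  LpBesovNorm T p α q u
    + ⨆ (τ : ℝ) (_ : τ ≠ 0),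
        timeLpOn (Set.Ioo (max 0 τ) (min T (T + τ))) p
            (fun t => besovNorm α q fun x => u (t - τ) x - u t x)
          / ENNReal.ofReal (|τ| ^ β)

/-- `u ∈ B^β_{p,∞}((0,T);B^α_{q,∞}(𝕋^d))`. -/
def MemBesovBesov (T β : ℝ) (p : ℝ≥0∞) (α : ℝ) (q : ℝ≥0∞)
    (u : ℝ → (Fin d → ℝ) → E) : Prop :=
  besovBesovNorm T β p α q u < ∞

/-- Classical partial derivative in time of a space-time function. -/
def pderivT (φ : ℝ → (Fin d → ℝ) → ℝ) (t : ℝ) (x : Fin d → ℝ) : ℝ :=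
  deriv (fun s => φ s x) t

/-- Classical partial derivative in the `i`-th space direction of a space-time function. -/
def pderivX (i : Fin d) (φ : ℝ → (Fin d → ℝ) → ℝ) (t : ℝ) (x : Fin d → ℝ) : ℝ :=
  fderiv ℝ (φ t) x (Pi.single i 1)

/-- Smooth test functions on `(0,T) × 𝕋^d`, compactly supported away from `t = 0` and
`t = T`, and periodic in space. -/
structure IsTestFunction (T : ℝ) (φ : ℝ → (Fin d → ℝ) → ℝ) : Prop where
  smooth : ContDiff ℝ (⊤ : ℕ∞) (Function.uncurry φ)
  periodic : ∀ t, SpacePeriodic (φ t)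
  supp : ∃ a b : ℝ, 0 < a ∧ b < T ∧ ∀ t x, t ∉ Set.Icc a b → φ t x = 0

/-- Smooth test functions on `[0,T) × 𝕋^d` (allowed to be nonzero at the initial time),
vanishing near `t = T`, and periodic in space. -/
structure IsTestFunctionIC (T : ℝ) (φ : ℝ → (Fin d → ℝ) → ℝ) : Prop where
  smooth : ContDiff ℝ (⊤ : ℕ∞) (Function.uncurry φ)
  periodic : ∀ t, SpacePeriodic (φ t)
  supp : ∃ b : ℝ, b < T ∧ ∀ t x, b ≤ t → φ t x = 0

/-- `g` is the weak time derivative of `f` on `(0,T) × 𝕋^d`. -/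
def HasWeakDerivT (T : ℝ) (f g : ℝ → (Fin d → ℝ) → ℝ) : Prop :=
  ∀ φ : ℝ → (Fin d → ℝ) → ℝ, IsTestFunction T φ →
    ∫ t in Set.Ioo 0 T, ∫ x in unitCube d, f t x * pderivT φ t x
      = - ∫ t in Set.Ioo 0 T, ∫ x in unitCube d, g t x * φ t x

/-- `g` is the weak `i`-th spatial derivative of `f` on `(0,T) × 𝕋^d`. -/
def HasWeakDerivX (T : ℝ) (i : Fin d) (f g : ℝ → (Fin d → ℝ) → ℝ) : Prop :=
  ∀ φ : ℝ → (Fin d → ℝ) → ℝ, IsTestFunction T φ →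
    ∫ t in Set.Ioo 0 T, ∫ x in unitCube d, f t x * pderivX i φ t x
      = - ∫ t in Set.Ioo 0 T, ∫ x in unitCube d, g t x * φ t x

/-- The weak time derivative of `f` belongs to `L^a(0,T;L^b(𝕋^d))`. -/
def DtInLpLq (T : ℝ) (a b : ℝ≥0∞) (f : ℝ → (Fin d → ℝ) → ℝ) : Prop :=
  ∃ g : ℝ → (Fin d → ℝ) → ℝ, HasWeakDerivT T f g ∧ MemLpLq T a b g

/-- The weak spatial gradient of `f` belongs to `L^a(0,T;L^b(𝕋^d))`. -/
def GradInLpLq (T : ℝ) (a b : ℝ≥0∞) (f : ℝ → (Fin d → ℝ) → ℝ) : Prop :=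
  ∃ G : ℝ → (Fin d → ℝ) → Fin d → ℝ,
    (∀ i, HasWeakDerivX T i f fun t x => G t x i) ∧ MemLpLq T a b G

/-- The constant `κ = (γ-1)²/(4γ)` in the pressure law `π(ρ) = κ ρ^γ`. -/
def kappa (γ : ℝ) : ℝ := (γ - 1) ^ 2 / (4 * γ)

/-- The total energy `E(t) = ∫_{𝕋^d} (½ ρ|v|² + κργ/(γ-1)) dx` at time `t`. -/
def energyAt (d : ℕ) (γ : ℝ) (ρ : ℝ → (Fin d → ℝ) → ℝ)
    (v : ℝ → (Fin d → ℝ) → Fin d → ℝ) (t : ℝ) : ℝ :=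
  ∫ x in unitCube d,
    ((1 / 2 : ℝ) * ρ t x * euNorm (v t x) ^ 2 + (kappa γ / (γ - 1)) * ρ t x ^ γ)

/-- The initial energy `E(0)`. -/
def energyInit (d : ℕ) (γ : ℝ) (ρ₀ : (Fin d → ℝ) → ℝ)
    (v₀ : (Fin d → ℝ) → Fin d → ℝ) : ℝ :=
  ∫ x in unitCube d,
    ((1 / 2 : ℝ) * ρ₀ x * euNorm (v₀ x) ^ 2 + (kappa γ / (γ - 1)) * ρ₀ x ^ γ)

/-- A weak solution of the isentropic compressible Euler equations
`∂ₜρ + div(ρv) = 0`, `∂ₜ(ρv) + div(ρv⊗v) + ∇(κρ^γ) = 0` on `(0,T) × 𝕋^d`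
with initial data `ρ(0) = ρ₀`, `(ρv)(0) = ρ₀v₀`:
both equations hold in the sense of distributions, `ρ^γ, ρ|v|² ∈ L^∞(0,T;L¹(𝕋^d))`,
`ρ` is a renormalized solution of the continuity equation, and the energy
inequality `E(t) ≤ E(0)` holds. -/
structure IsWeakSolution (d : ℕ) (T γ : ℝ) (ρ : ℝ → (Fin d → ℝ) → ℝ)
    (v : ℝ → (Fin d → ℝ) → Fin d → ℝ) (ρ₀ : (Fin d → ℝ) → ℝ)
    (v₀ : (Fin d → ℝ) → Fin d → ℝ) : Prop where
  rho_meas : Measurable (Function.uncurry ρ)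
  v_meas : Measurable (Function.uncurry v)
  rho_periodic : ∀ t, SpacePeriodic (ρ t)
  v_periodic : ∀ t, SpacePeriodic (v t)
  rho0_periodic : SpacePeriodic ρ₀
  v0_periodic : SpacePeriodic v₀
  rho_nonneg : ∀ t x, 0 ≤ ρ t x
  rho0_nonneg : ∀ x, 0 ≤ ρ₀ x
  v0_vacuum : ∀ x, ρ₀ x = 0 → v₀ x = 0
  pressure_int : MemLpLq T ∞ 1 fun t x => ρ t x ^ γ
  kinetic_int : MemLpLq T ∞ 1 fun t x => ρ t x * euNorm (v t x) ^ 2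
  mass : ∀ φ : ℝ → (Fin d → ℝ) → ℝ, IsTestFunctionIC T φ →
    (∫ t in Set.Ioo 0 T, ∫ x in unitCube d,
        (ρ t x * pderivT φ t x + ρ t x * (∑ i, v t x i * pderivX i φ t x)))
      + (∫ x in unitCube d, ρ₀ x * φ 0 x) = 0
  momentum : ∀ Φ : ℝ → (Fin d → ℝ) → Fin d → ℝ,
    (∀ j, IsTestFunctionIC T fun s y => Φ s y j) →
    (∫ t in Set.Ioo 0 T, ∫ x in unitCube d,
        ((∑ j, ρ t x * v t x j * pderivT (fun s y => Φ s y j) t x)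
          + (∑ i, ∑ j, ρ t x * v t x i * v t x j * pderivX i (fun s y => Φ s y j) t x)
          + kappa γ * ρ t x ^ γ * (∑ j, pderivX j (fun s y => Φ s y j) t x)))
      + (∫ x in unitCube d, (∑ j, ρ₀ x * v₀ x j * Φ 0 x j)) = 0
  renormalized : ∃ w : ℝ → (Fin d → ℝ) → ℝ,
    (∀ φ : ℝ → (Fin d → ℝ) → ℝ, IsTestFunction T φ →
      ∫ t in Set.Ioo 0 T, ∫ x in unitCube d, (∑ i, v t x i * pderivX i φ t x)
        = - ∫ t in Set.Ioo 0 T, ∫ x in unitCube d, w t x * φ t x) ∧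
    ∀ b : ℝ → ℝ, ContDiff ℝ 1 b → HasCompactSupport (deriv b) →
      ∀ φ : ℝ → (Fin d → ℝ) → ℝ, IsTestFunctionIC T φ →
        (∫ t in Set.Ioo 0 T, ∫ x in unitCube d,
            (b (ρ t x) * pderivT φ t x + b (ρ t x) * (∑ i, v t x i * pderivX i φ t x)
              - (deriv b (ρ t x) * ρ t x - b (ρ t x)) * w t x * φ t x))
          + (∫ x in unitCube d, b (ρ₀ x) * φ 0 x) = 0
  energy_ineq : ∀ᵐ t ∂(volume.restrict (Set.Ioo 0 T)),
    energyAt d γ ρ v t ≤ energyInit d γ ρ₀ v₀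

/-- The exponent `p/(p-3)`, read as `∞` when `p ≤ 3`. -/
def div3Exp (p : ℝ) : ℝ≥0∞ := if p ≤ 3 then ∞ else ENNReal.ofReal (p / (p - 3))

/-- The standard (non-normalized) spatial bump `e^{-1/(1-|x|²)}` for `|x| < 1`. -/
def bump (d : ℕ) (x : Fin d → ℝ) : ℝ :=
  if euNorm x < 1 then Real.exp (-(1 - euNorm x ^ 2)⁻¹) else 0

/-- The normalizing constant `C₀` with `∫ C₀ e^{-1/(1-|x|²)} dx = 1`. -/
def bumpConst (d : ℕ) : ℝ := (∫ x : Fin d → ℝ, bump d x)⁻¹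

/-- The rescaled standard spatial mollifier `η_ε(x) = ε^{-d} η(x/ε)`,
`η(x) = C₀ e^{-1/(1-|x|²)}`. -/
def sKer (d : ℕ) (ε : ℝ) (x : Fin d → ℝ) : ℝ :=
  (ε ^ d)⁻¹ * (bumpConst d * bump d (ε⁻¹ • x))

/-- Mollification in the space variable: `f^ε = f * η_ε`. -/
def sMollify {d : ℕ} {E : Type*} [NormedAddCommGroup E] [NormedSpace ℝ E]
    (ε : ℝ) (f : (Fin d → ℝ) → E) (x : Fin d → ℝ) : E :=
  ∫ y : Fin d → ℝ, sKer d ε (x - y) • f y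

/-- A space-time mollifying kernel: nonnegative, smooth, supported in the unit ball of
`ℝ^{1+d}`, with integral 1. -/
structure IsSTMollifier (d : ℕ) (η : ℝ → (Fin d → ℝ) → ℝ) : Prop where
  smooth : ContDiff ℝ (⊤ : ℕ∞) (Function.uncurry η)
  nonneg : ∀ t x, 0 ≤ η t x
  supp : ∀ t x, 1 ≤ t ^ 2 + euNorm x ^ 2 → η t x = 0
  integral_one : (∫ z : ℝ × (Fin d → ℝ), η z.1 z.2) = 1

/-- The rescaled space-time kernel `η_ε(t,x) = ε^{-(d+1)} η(t/ε, x/ε)`. -/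
def stKer (d : ℕ) (η : ℝ → (Fin d → ℝ) → ℝ) (ε : ℝ) (t : ℝ) (x : Fin d → ℝ) : ℝ :=
  (ε ^ (d + 1))⁻¹ * η (t / ε) (ε⁻¹ • x)

/-- Space-time mollification `f^ε(t,x) = ∫∫ η_ε(t-s, x-y) f(s,y) dy ds`. -/
def stMollify {d : ℕ} {E : Type*} [NormedAddCommGroup E] [NormedSpace ℝ E]
    (η : ℝ → (Fin d → ℝ) → ℝ) (ε : ℝ) (f : ℝ → (Fin d → ℝ) → E)
    (t : ℝ) (x : Fin d → ℝ) : E :=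
  ∫ z : ℝ × (Fin d → ℝ), stKer d η ε (t - z.1) (x - z.2) • f z.1 z.2


/-- The `L^p(0,T;Ḃ^α_{q,∞}(𝕋^d))` (homogeneous) seminorm. -/
def LpHomBesovNorm {d : ℕ} (T : ℝ) (p : ℝ≥0∞) (α : ℝ) (q : ℝ≥0∞)
    (u : ℝ → (Fin d → ℝ) → ℝ) : ℝ≥0∞ :=
  timeLpOn (Set.Ioo 0 T) p fun t => besovSeminorm α q (u t)

section helpers

theorem aux_timeLpOn_eq (s : Set ℝ) {p : ℝ≥0∞} (hp : p ≠ 0) (F : ℝ → ℝ≥0∞) :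
    timeLpOn s p F = eLpNorm F p (volume.restrict s) := by
  unfold timeLpOn
  split_ifs with h
  · subst h
    simp [eLpNorm_exponent_top, eLpNormEssSup]
  · rw [eLpNorm_eq_lintegral_rpow_enorm_toReal hp h]
    simp

theorem aux_holder_top {α : Type*} [MeasurableSpace α] {μ : Measure α} (p : ℝ≥0∞)
    {F G : α → ℝ≥0∞} (hG : AEMeasurable G μ) :
    eLpNorm (fun x => F x * G x) p μ ≤ eLpNorm F ∞ μ * eLpNorm G p μ := by
  obtain (rfl | rfl | hp) := ENNReal.trichotomy p
  · simp
  · simp_rw [eLpNorm_exponent_top, eLpNormEssSup, enorm_eq_self]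
    exact ENNReal.essSup_mul_le F G
  obtain ⟨hp₁, hp₂⟩ := ENNReal.toReal_pos_iff.mp hp
  simp_rw [eLpNorm_eq_lintegral_rpow_enorm_toReal hp₁.ne' hp₂.ne, eLpNorm_exponent_top,
    eLpNormEssSup, one_div, ENNReal.rpow_inv_le_iff hp, enorm_eq_self]
  rw [ENNReal.mul_rpow_of_nonneg (hz := hp.le), ENNReal.rpow_inv_rpow hp.ne',
    ← lintegral_const_mul'' _ (by fun_prop)]
  simp only [← ENNReal.mul_rpow_of_nonneg (hz := hp.le)]
  apply lintegral_mono_ae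
  filter_upwards [ENNReal.ae_le_essSup F] with x hf
  gcongr

theorem aux_holder {α : Type*} [MeasurableSpace α] {μ : Measure α} {p q r : ℝ≥0∞}
    {F G : α → ℝ≥0∞} (hF : AEMeasurable F μ) (hG : AEMeasurable G μ)
    (hp0 : p ≠ 0) (hq0 : q ≠ 0) (hpqr : 1 / r = 1 / p + 1 / q) :
    eLpNorm (fun x => F x * G x) r μ ≤ eLpNorm F p μ * eLpNorm G q μ := by
  obtain (rfl | rfl | hp) := ENNReal.trichotomy p
  · simp_all
  · have : r = q := by simpa using hpqr
    exact this ▸ aux_holder_top r hG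
  obtain (rfl | rfl | hq) := ENNReal.trichotomy q
  · simp_all
  · have : r = p := by simpa using hpqr
    subst this
    simp_rw [mul_comm (F _)]
    rw [mul_comm]
    exact aux_holder_top _ hF
  obtain ⟨hp₁, hp₂⟩ := ENNReal.toReal_pos_iff.mp hp
  obtain ⟨hq₁, hq₂⟩ := ENNReal.toReal_pos_iff.mp hq
  have hpqr' : 1 / r.toReal = 1 / p.toReal + 1 / q.toReal := by
    have := congrArg ENNReal.toReal hpqr
    rw [ENNReal.toReal_add (by simpa using hp₁.ne') (by simpa using hq₁.ne')] at this
    simpa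
  have hr : 0 < r.toReal := one_div_pos.mp <| by rw [hpqr']; positivity
  obtain ⟨hr₁, hr₂⟩ := ENNReal.toReal_pos_iff.mp hr
  have hrp : r.toReal < p.toReal := lt_of_one_div_lt_one_div hp <|
    hpqr' ▸ lt_add_of_pos_right _ (by positivity)
  rw [eLpNorm_eq_lintegral_rpow_enorm_toReal hr₁.ne' hr₂.ne,
    eLpNorm_eq_lintegral_rpow_enorm_toReal hp₁.ne' hp₂.ne,
    eLpNorm_eq_lintegral_rpow_enorm_toReal hq₁.ne' hq₂.ne]
  simp only [enorm_eq_self]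
  exact ENNReal.lintegral_Lp_mul_le_Lq_mul_Lr hr hrp hpqr' μ hF hG

theorem aux_measurable_essSup {α β : Type*} [MeasurableSpace α] [MeasurableSpace β]
    {ν : Measure β} [SFinite ν] {F : α → β → ℝ≥0∞} (hF : Measurable (Function.uncurry F)) :
    Measurable (fun a => essSup (F a) ν) := by
  apply measurable_of_Iic
  intro c
  have hs : MeasurableSet {z : α × β | c < Function.uncurry F z} :=
    measurableSet_lt measurable_const hF
  have := measurable_measure_prodMk_left (ν := ν) hs
  convert this (measurableSet_singleton 0) using 1
  ext a
  simp only [Set.mem_preimage, Set.mem_Iic, Set.mem_singleton_iff]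
  constructor
  · intro h
    have h2 : ∀ᵐ b ∂ν, F a b ≤ c := by
      filter_upwards [ENNReal.ae_le_essSup (μ := ν) (F a)] with b hb using hb.trans h
    rw [ae_iff] at h2
    simpa [Function.uncurry] using h2
  · intro h
    refine essSup_le_of_ae_le c ?_
    change ∀ᵐ b ∂ν, F a b ≤ c
    rw [ae_iff]
    simpa [Function.uncurry] using h

theorem aux_measurable_eLpNorm {α β : Type*} [MeasurableSpace α] [MeasurableSpace β]
    {ν : Measure β} [SFinite ν] {F : α → β → ℝ≥0∞} (hF : Measurable (Function.uncurry F))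
    {q : ℝ≥0∞} (hq : q ≠ 0) :
    Measurable (fun a => eLpNorm (F a) q ν) := by
  by_cases h : q = ∞
  · subst h
    simpa [eLpNorm_exponent_top, eLpNormEssSup] using aux_measurable_essSup hF
  · simp_rw [eLpNorm_eq_lintegral_rpow_enorm_toReal hq h, enorm_eq_self]
    apply Measurable.pow_const
    exact Measurable.lintegral_prod_right (f := fun x y => F x y ^ q.toReal) (hF.pow_const _)

theorem aux_mink {α β : Type*} [MeasurableSpace α] [MeasurableSpace β]
    {μ : Measure α} [SFinite μ] {ν : Measure β} [IsProbabilityMeasure ν] {F : α → β → ℝ≥0∞}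
    (hF : Measurable (Function.uncurry F)) {q : ℝ≥0∞} (hq : 1 ≤ q) {M : ℝ≥0∞}
    (h : ∀ᵐ y ∂ν, eLpNorm (fun x => F x y) q μ ≤ M) :
    eLpNorm (fun x => ∫⁻ y, F x y ∂ν) q μ ≤ M := by
  by_cases hqt : q = ∞
  · subst hqt
    simp only [eLpNorm_exponent_top, eLpNormEssSup, enorm_eq_self] at h ⊢
    have h1 : ∀ᵐ y ∂ν, ∀ᵐ x ∂μ, F x y ≤ M := by
      filter_upwards [h] with y hy
      filter_upwards [ENNReal.ae_le_essSup (μ := μ) (fun x => F x y)] with x hx using hx.trans hy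
    have h2 : ∀ᵐ x ∂μ, ∀ᵐ y ∂ν, F x y ≤ M :=
      (Measure.ae_ae_comm (p := fun x y => F x y ≤ M) (measurableSet_le hF measurable_const)).2 h1
    refine essSup_le_of_ae_le M ?_
    filter_upwards [h2] with x hx
    calc ∫⁻ y, F x y ∂ν ≤ ∫⁻ y, M ∂ν := lintegral_mono_ae hx
      _ = M := by simp
  · have hq0 : q ≠ 0 := (zero_lt_one.trans_le hq).ne'
    have hqr : 0 < q.toReal := ENNReal.toReal_pos hq0 hqt
    simp only [eLpNorm_eq_lintegral_rpow_enorm_toReal hq0 hqt, enorm_eq_self, one_div,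
      ENNReal.rpow_inv_le_iff hqr] at h ⊢
    have jensen : ∀ x, (∫⁻ y, F x y ∂ν) ^ q.toReal ≤ ∫⁻ y, F x y ^ q.toReal ∂ν := by
      intro x
      have hm : Measurable (F x) := hF.comp measurable_prodMk_left
      have := eLpNorm_le_eLpNorm_of_exponent_le hq (μ := ν) hm.aestronglyMeasurable
      rw [eLpNorm_one_eq_lintegral_enorm, eLpNorm_eq_lintegral_rpow_enorm_toReal hq0 hqt, one_div,
        ENNReal.le_rpow_inv_iff hqr] at this
      simpa using this
    calc ∫⁻ x, (∫⁻ y, F x y ∂ν) ^ q.toReal ∂μ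
        ≤ ∫⁻ x, ∫⁻ y, F x y ^ q.toReal ∂ν ∂μ := lintegral_mono jensen
      _ = ∫⁻ y, ∫⁻ x, F x y ^ q.toReal ∂μ ∂ν :=
          lintegral_lintegral_swap (hF.pow_const _).aemeasurable
      _ ≤ ∫⁻ y, M ^ q.toReal ∂ν := lintegral_mono_ae h
      _ = M ^ q.toReal := by simp

theorem aux_mink_int {α β : Type*} [MeasurableSpace α] [MeasurableSpace β]
    {μ : Measure α} [SFinite μ] {ν : Measure β} [IsProbabilityMeasure ν] {a : α → β → ℝ}
    (ha : Measurable (Function.uncurry a)) {q : ℝ≥0∞} (hq : 1 ≤ q) {M : ℝ≥0∞} (hM : M < ∞)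
    (h : ∀ᵐ y ∂ν, eLpNorm (fun x => ‖a x y‖ₑ) q μ ≤ M) :
    ∀ᵐ x ∂μ, Integrable (a x) ν := by
  have h1 := aux_mink (F := fun x y => ‖a x y‖ₑ) ha.enorm hq h
  have hq0 : q ≠ 0 := (zero_lt_one.trans_le hq).ne'
  have hm : Measurable fun x => ∫⁻ y, ‖a x y‖ₑ ∂ν :=
    Measurable.lintegral_prod_right (f := fun x y => ‖a x y‖ₑ) ha.enorm
  have h2 : ∀ᵐ x ∂μ, ∫⁻ y, ‖a x y‖ₑ ∂ν < ∞ := by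
    have h3 := h1.trans_lt hM
    by_cases hqt : q = ∞
    · subst hqt
      simp only [eLpNorm_exponent_top, eLpNormEssSup, enorm_eq_self] at h3
      filter_upwards [ENNReal.ae_le_essSup (μ := μ) (fun x => ∫⁻ y, ‖a x y‖ₑ ∂ν)] with x hx
      exact hx.trans_lt h3
    · have hqr : 0 < q.toReal := ENNReal.toReal_pos hq0 hqt
      simp only [eLpNorm_eq_lintegral_rpow_enorm_toReal hq0 hqt, enorm_eq_self, one_div] at h3
      rw [ENNReal.rpow_lt_top_iff_of_pos (by positivity)] at h3
      filter_upwards [ae_lt_top (hm.pow_const _) h3.ne] with x hx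
      rwa [ENNReal.rpow_lt_top_iff_of_pos hqr] at hx
  filter_upwards [h2] with x hx
  exact ⟨(ha.comp measurable_prodMk_left).aestronglyMeasurable, hx⟩

theorem aux_cov {β : Type*} [MeasurableSpace β] {ν : Measure β} [IsProbabilityMeasure ν]
    {u v : β → ℝ} (c e : ℝ) (hu : Integrable (fun y => u y - c) ν)
    (hv : Integrable (fun y => v y - e) ν)
    (huv : Integrable (fun y => (u y - c) * (v y - e)) ν) :
    ∫ y, u y * v y ∂ν - (∫ y, u y ∂ν) * (∫ y, v y ∂ν)
      = ∫ y, (u y - c) * (v y - e) ∂ν - (∫ y, (u y - c) ∂ν) * (∫ y, (v y - e) ∂ν) := by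
  have e1 : ∫ y, u y ∂ν = ∫ y, (u y - c) ∂ν + c := by
    have : u = fun y => (u y - c) + c := by ext y; ring
    conv_lhs => rw [this]
    rw [integral_add hu (integrable_const _)]; simp
  have e2 : ∫ y, v y ∂ν = ∫ y, (v y - e) ∂ν + e := by
    have : v = fun y => (v y - e) + e := by ext y; ring
    conv_lhs => rw [this]
    rw [integral_add hv (integrable_const _)]; simp
  have e3 : ∫ y, u y * v y ∂ν = ∫ y, (u y - c) * (v y - e) ∂ν + e * ∫ y, (u y - c) ∂ν
      + c * ∫ y, (v y - e) ∂ν + c * e := by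
    have : (fun y => u y * v y) = fun y => (u y - c) * (v y - e) + e * (u y - c)
      + c * (v y - e) + c * e := by ext y; ring
    have j1 : Integrable (fun y => (u y - c) * (v y - e) + e * (u y - c)) ν :=
      huv.add (hu.const_mul e)
    have j2 : Integrable (fun y => (u y - c) * (v y - e) + e * (u y - c) + c * (v y - e)) ν :=
      j1.add (hv.const_mul c)
    rw [this, integral_add j2 (integrable_const _), integral_add j1 (hv.const_mul c),
      integral_add huv (hu.const_mul e), integral_const_mul, integral_const_mul]
    simp
  rw [e1, e2, e3]; ring

/-- Abstract commutator estimate for a probability measure of shifts. -/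
theorem aux_comm {α β : Type*} [MeasurableSpace α] [MeasurableSpace β]
    {μ : Measure α} [SFinite μ] {ν : Measure β} [IsProbabilityMeasure ν]
    {u v : α → β → ℝ} {u₀ v₀ : α → ℝ}
    (hu : Measurable (Function.uncurry fun x y => u x y - u₀ x))
    (hv : Measurable (Function.uncurry fun x y => v x y - v₀ x))
    {q q₁ q₂ : ℝ≥0∞} (hq : 1 ≤ q) (hq₁ : 1 ≤ q₁) (hq₂ : 1 ≤ q₂)
    (hqq : 1 / q = 1 / q₁ + 1 / q₂) {A B : ℝ≥0∞} (hA : A < ∞) (hB : B < ∞)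
    (h1 : ∀ᵐ y ∂ν, eLpNorm (fun x => ‖u x y - u₀ x‖ₑ) q₁ μ ≤ A)
    (h2 : ∀ᵐ y ∂ν, eLpNorm (fun x => ‖v x y - v₀ x‖ₑ) q₂ μ ≤ B) :
    eLpNorm (fun x => ∫ y, u x y * v x y ∂ν - (∫ y, u x y ∂ν) * (∫ y, v x y ∂ν)) q μ
      ≤ 2 * (A * B) := by
  have hq₁0 : q₁ ≠ 0 := (zero_lt_one.trans_le hq₁).ne'
  have hq₂0 : q₂ ≠ 0 := (zero_lt_one.trans_le hq₂).ne'
  set a : α → β → ℝ := fun x y => u x y - u₀ x with ha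
  set b : α → β → ℝ := fun x y => v x y - v₀ x with hb
  have hab : Measurable (Function.uncurry fun x y => a x y * b x y) := hu.mul hv
  have h3 : ∀ᵐ y ∂ν, eLpNorm (fun x => ‖a x y * b x y‖ₑ) q μ ≤ A * B := by
    filter_upwards [h1, h2] with y hy1 hy2
    simp_rw [enorm_mul]
    refine (aux_holder ?_ ?_ hq₁0 hq₂0 hqq).trans (mul_le_mul' hy1 hy2)
    · exact (hu.enorm.comp measurable_prodMk_right).aemeasurable
    · exact (hv.enorm.comp measurable_prodMk_right).aemeasurable
  have hAB : A * B < ∞ := ENNReal.mul_lt_top hA hB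
  have i1 := aux_mink_int hu hq₁ hA h1
  have i2 := aux_mink_int hv hq₂ hB h2
  have i3 := aux_mink_int hab hq hAB h3
  have m1 : Measurable fun x => ∫⁻ y, ‖a x y‖ₑ ∂ν :=
    Measurable.lintegral_prod_right (f := fun x y => ‖a x y‖ₑ) hu.enorm
  have m2 : Measurable fun x => ∫⁻ y, ‖b x y‖ₑ ∂ν :=
    Measurable.lintegral_prod_right (f := fun x y => ‖b x y‖ₑ) hv.enorm
  have m3 : Measurable fun x => ∫⁻ y, ‖a x y * b x y‖ₑ ∂ν :=
    Measurable.lintegral_prod_right (f := fun x y => ‖a x y * b x y‖ₑ) hab.enorm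
  calc eLpNorm (fun x => ∫ y, u x y * v x y ∂ν - (∫ y, u x y ∂ν) * (∫ y, v x y ∂ν)) q μ
      ≤ eLpNorm ((fun x => ∫⁻ y, ‖a x y * b x y‖ₑ ∂ν) +
          fun x => (∫⁻ y, ‖a x y‖ₑ ∂ν) * ∫⁻ y, ‖b x y‖ₑ ∂ν) q μ := by
        apply eLpNorm_mono_enorm_ae
        filter_upwards [i1, i2, i3] with x hx1 hx2 hx3
        rw [aux_cov (u₀ x) (v₀ x) hx1 hx2 hx3]
        refine (enorm_sub_le).trans ?_
        rw [enorm_mul]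
        simp only [Pi.add_apply, enorm_eq_self]
        gcongr <;> exact enorm_integral_le_lintegral_enorm _
    _ ≤ eLpNorm (fun x => ∫⁻ y, ‖a x y * b x y‖ₑ ∂ν) q μ +
          eLpNorm (fun x => (∫⁻ y, ‖a x y‖ₑ ∂ν) * ∫⁻ y, ‖b x y‖ₑ ∂ν) q μ :=
        eLpNorm_add_le m3.aestronglyMeasurable (m1.mul m2).aestronglyMeasurable hq
    _ ≤ A * B + A * B := by
        gcongr
        · exact aux_mink hab.enorm hq h3
        · refine (aux_holder m1.aemeasurable m2.aemeasurable hq₁0 hq₂0 hqq).trans ?_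
          exact mul_le_mul' (aux_mink hu.enorm hq₁ h1) (aux_mink hv.enorm hq₂ h2)
    _ = 2 * (A * B) := by ring

theorem aux_continuous_euNorm (d : ℕ) : Continuous (euNorm (d := d)) := by
  unfold euNorm; fun_prop

theorem aux_abs_le_euNorm {d : ℕ} (x : Fin d → ℝ) (i : Fin d) : |x i| ≤ euNorm x := by
  unfold euNorm
  apply Real.abs_le_sqrt
  exact Finset.single_le_sum (f := fun i => x i ^ 2) (fun i _ => sq_nonneg _) (Finset.mem_univ i)

theorem aux_euNorm_smul {d : ℕ} (c : ℝ) (hc : 0 ≤ c) (x : Fin d → ℝ) :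
    euNorm (c • x) = c * euNorm x := by
  unfold euNorm
  simp only [Pi.smul_apply, smul_eq_mul, mul_pow]
  rw [← Finset.mul_sum, Real.sqrt_mul (sq_nonneg c), Real.sqrt_sq hc]

theorem aux_euNorm_pos {d : ℕ} {x : Fin d → ℝ} (hx : x ≠ 0) : 0 < euNorm x := by
  obtain ⟨i, hi⟩ := Function.ne_iff.1 hx
  exact (abs_pos.2 hi).trans_le (aux_abs_le_euNorm x i)

theorem aux_measurable_bump (d : ℕ) : Measurable (bump d) := by
  have hm := (aux_continuous_euNorm d).measurable
  unfold bump
  exact Measurable.ite (measurableSet_lt hm measurable_const) (by fun_prop) measurable_const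

theorem aux_bump_nonneg (d : ℕ) (x : Fin d → ℝ) : 0 ≤ bump d x := by
  unfold bump; split_ifs <;> positivity

theorem aux_bump_integrable (d : ℕ) : Integrable (bump d) := by
  have hs : Function.support (bump d) ⊆ Metric.closedBall 0 1 := by
    intro x hx
    have : euNorm x < 1 := by
      by_contra h
      exact hx (by simp [bump, h])
    rw [mem_closedBall_zero_iff, pi_norm_le_iff_of_nonneg zero_le_one]
    exact fun i => (aux_abs_le_euNorm x i).trans this.le
  rw [← integrableOn_iff_integrable_of_support_subset hs]
  refine Measure.integrableOn_of_bounded (M := 1) (measure_closedBall_lt_top).ne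
    (aux_measurable_bump d).aestronglyMeasurable ?_
  refine Filter.Eventually.of_forall fun x => ?_
  rw [Real.norm_of_nonneg (aux_bump_nonneg d x)]
  unfold bump
  split_ifs with h
  · apply Real.exp_le_one_iff.2
    have h0 : 0 ≤ euNorm x := Real.sqrt_nonneg _
    have : 0 < 1 - euNorm x ^ 2 := by nlinarith
    have := inv_pos.2 this
    linarith
  · exact zero_le_one

theorem aux_bump_integral_pos (d : ℕ) : 0 < ∫ x, bump d x := by
  rw [integral_pos_iff_support_of_nonneg (aux_bump_nonneg d) (aux_bump_integrable d)]
  have hs : Function.support (bump d) = {x | euNorm x < 1} := by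
    ext x
    simp only [Function.mem_support, bump, Set.mem_ofPred_eq]
    split_ifs with h <;> simp [h, Real.exp_ne_zero]
  rw [hs]
  exact (isOpen_lt (aux_continuous_euNorm d) continuous_const).measure_pos _
    ⟨0, by simp [euNorm]⟩

theorem aux_measurable_sKer (d : ℕ) (ε : ℝ) : Measurable (sKer d ε) := by
  have := aux_measurable_bump d
  unfold sKer; fun_prop

theorem aux_sKer_nonneg (d : ℕ) {ε : ℝ} (hε : 0 < ε) (x : Fin d → ℝ) : 0 ≤ sKer d ε x := by
  have := aux_bump_nonneg d (ε⁻¹ • x)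
  have := aux_bump_integral_pos d
  unfold sKer bumpConst; positivity

theorem aux_sKer_integrable (d : ℕ) {ε : ℝ} (hε : 0 < ε) : Integrable (sKer d ε) := by
  unfold sKer
  refine Integrable.const_mul (Integrable.const_mul ?_ _) _
  exact (aux_bump_integrable d).comp_smul (inv_pos.2 hε).ne'

theorem aux_sKer_integral (d : ℕ) {ε : ℝ} (hε : 0 < ε) : ∫ x, sKer d ε x = 1 := by
  unfold sKer
  rw [integral_const_mul, integral_const_mul, Measure.integral_comp_inv_smul_of_nonneg _ _ hε.le]
  have := (aux_bump_integral_pos d).ne'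
  simp only [bumpConst, Module.finrank_fin_fun, smul_eq_mul]
  field_simp

/-- The mollifying probability measure. -/
def auxNu (d : ℕ) (ε : ℝ) : Measure (Fin d → ℝ) :=
  volume.withDensity fun y => ENNReal.ofReal (sKer d ε y)

theorem auxNu_prob (d : ℕ) {ε : ℝ} (hε : 0 < ε) : IsProbabilityMeasure (auxNu d ε) := by
  constructor
  rw [auxNu, withDensity_apply _ MeasurableSet.univ, Measure.restrict_univ,
    ← ofReal_integral_eq_lintegral_ofReal (aux_sKer_integrable d hε)
      (Filter.Eventually.of_forall (aux_sKer_nonneg d hε)), aux_sKer_integral d hε]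
  simp

theorem auxNu_ae (d : ℕ) {ε : ℝ} (hε : 0 < ε) : ∀ᵐ y ∂(auxNu d ε), euNorm y ≤ ε := by
  rw [auxNu, ae_withDensity_iff (aux_measurable_sKer d ε).ennreal_ofReal]
  refine Filter.Eventually.of_forall fun y hy => ?_
  by_contra h
  push Not at h
  apply hy
  have : ¬ euNorm (ε⁻¹ • y) < 1 := by
    rw [aux_euNorm_smul _ (inv_pos.2 hε).le, not_lt, inv_mul_eq_div, one_le_div hε]
    exact h.le
  simp [sKer, bump, this]

theorem aux_sMollify_eq {d : ℕ} {ε : ℝ} (hε : 0 < ε) (f : (Fin d → ℝ) → ℝ) (x : Fin d → ℝ) :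
    sMollify ε f x = ∫ y, f (x - y) ∂(auxNu d ε) := by
  rw [auxNu, integral_withDensity_eq_integral_toReal_smul
    (aux_measurable_sKer d ε).ennreal_ofReal (by simp)]
  simp_rw [ENNReal.toReal_ofReal (aux_sKer_nonneg d hε _)]
  rw [sMollify, ← integral_sub_left_eq_self _ _ x]
  simp

/-- Measurable version of the seminorm, at scale `ε`. -/
def auxE {d : ℕ} (ε : ℝ) (q : ℝ≥0∞) (f : (Fin d → ℝ) → ℝ) : ℝ≥0∞ :=
  essSup (fun y => eLpNorm (fun x => ‖f (x - y) - f x‖ₑ) q (cubeVol d)) (auxNu d ε)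

theorem auxE_le {d : ℕ} {ε α : ℝ} (hε : 0 < ε) (hα : 0 < α) (q : ℝ≥0∞) (f : (Fin d → ℝ) → ℝ) :
    auxE ε q f ≤ ENNReal.ofReal (ε ^ α) * besovSeminorm α q f := by
  refine essSup_le_of_ae_le _ ?_
  filter_upwards [auxNu_ae d hε] with y hy
  rw [eLpNorm_enorm]
  by_cases h0 : y = 0
  · subst h0; simp
  have hpos := Real.rpow_pos_of_pos (aux_euNorm_pos h0) α
  calc eLpNorm (fun x => f (x - y) - f x) q (cubeVol d)
      = ENNReal.ofReal (euNorm y ^ α) * (eLpNorm (fun x => f (x - y) - f x) q (cubeVol d)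
          / ENNReal.ofReal (euNorm y ^ α)) := by
        rw [ENNReal.mul_div_cancel (by simpa using hpos) (by simp)]
    _ ≤ ENNReal.ofReal (ε ^ α) * besovSeminorm α q f := by
        gcongr
        · exact Real.sqrt_nonneg _
        · exact le_iSup₂_of_le y h0 le_rfl

theorem aux_cubeVol_sfinite (d : ℕ) : SFinite (cubeVol d) := by unfold cubeVol; infer_instance

theorem auxE_measurable {d : ℕ} {ε : ℝ} (hε : 0 < ε) {q : ℝ≥0∞} (hq : q ≠ 0)
    {f : ℝ → (Fin d → ℝ) → ℝ} (hf : Measurable (Function.uncurry f)) :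
    Measurable fun t => auxE ε q (f t) := by
  have := auxNu_prob d hε
  have := aux_cubeVol_sfinite d
  unfold auxE
  apply aux_measurable_essSup
    (F := fun t y => eLpNorm (fun x => ‖f t (x - y) - f t x‖ₑ) q (cubeVol d))
  apply aux_measurable_eLpNorm (α := ℝ × (Fin d → ℝ))
    (F := fun z x => ‖f z.1 (x - z.2) - f z.1 x‖ₑ) _ hq
  have e1 : Measurable fun w : (ℝ × (Fin d → ℝ)) × (Fin d → ℝ) => f w.1.1 (w.2 - w.1.2) :=
    hf.comp (f := fun w : (ℝ × (Fin d → ℝ)) × (Fin d → ℝ) => (w.1.1, w.2 - w.1.2)) (by fun_prop)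
  have e2 : Measurable fun w : (ℝ × (Fin d → ℝ)) × (Fin d → ℝ) => f w.1.1 w.2 :=
    hf.comp (f := fun w : (ℝ × (Fin d → ℝ)) × (Fin d → ℝ) => (w.1.1, w.2)) (by fun_prop)
  exact (e1.sub e2).enorm

theorem aux_space {d : ℕ} {ε : ℝ} (hε : 0 < ε) {f g : (Fin d → ℝ) → ℝ}
    (hf : Measurable f) (hg : Measurable g)
    {q q₁ q₂ : ℝ≥0∞} (hq : 1 ≤ q) (hq₁ : 1 ≤ q₁) (hq₂ : 1 ≤ q₂)
    (hqq : 1 / q = 1 / q₁ + 1 / q₂) (hA : auxE ε q₁ f < ∞) (hB : auxE ε q₂ g < ∞) :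
    eLpNorm (fun x => sMollify ε (fun y => f y * g y) x
              - sMollify ε f x * sMollify ε g x) q (cubeVol d)
      ≤ 2 * (auxE ε q₁ f * auxE ε q₂ g) := by
  have := auxNu_prob d hε
  have := aux_cubeVol_sfinite d
  simp_rw [aux_sMollify_eq hε]
  refine aux_comm (u := fun x y => f (x - y)) (v := fun x y => g (x - y)) (u₀ := f) (v₀ := g)
    ?_ ?_ hq hq₁ hq₂ hqq hA hB (ENNReal.ae_le_essSup _) (ENNReal.ae_le_essSup _)
  · exact (hf.comp (measurable_fst.sub measurable_snd)).sub (hf.comp measurable_fst)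
  · exact (hg.comp (measurable_fst.sub measurable_snd)).sub (hg.comp measurable_fst)

theorem aux_const_mul {μ : Measure ℝ} {p : ℝ≥0∞} (hp : p ≠ 0) {c : ℝ≥0∞} (hc : c ≠ ∞)
    (F : ℝ → ℝ≥0∞) : eLpNorm (fun t => c * F t) p μ ≤ c * eLpNorm F p μ := by
  by_cases hpt : p = ∞
  · subst hpt
    simp only [eLpNorm_exponent_top, eLpNormEssSup, enorm_eq_self]
    exact (ENNReal.essSup_const_mul).le
  · have hpr : 0 < p.toReal := ENNReal.toReal_pos hp hpt
    simp only [eLpNorm_eq_lintegral_rpow_enorm_toReal hp hpt, enorm_eq_self,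
      ENNReal.mul_rpow_of_nonneg _ _ hpr.le]
    rw [lintegral_const_mul' _ _ (by finiteness), ENNReal.mul_rpow_of_nonneg _ _ (by positivity),
      ← ENNReal.rpow_mul, mul_one_div_cancel hpr.ne', ENNReal.rpow_one]

theorem aux_ae_fin {μ : Measure ℝ} {p : ℝ≥0∞} (hp : p ≠ 0)
    {F : ℝ → ℝ≥0∞} (hF : Measurable F) (h : eLpNorm F p μ < ∞) : ∀ᵐ t ∂μ, F t < ∞ := by
  by_cases hqt : p = ∞
  · subst hqt
    simp only [eLpNorm_exponent_top, eLpNormEssSup, enorm_eq_self] at h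
    filter_upwards [ENNReal.ae_le_essSup (μ := μ) F] with x hx
    exact hx.trans_lt h
  · have hqr : 0 < p.toReal := ENNReal.toReal_pos hp hqt
    simp only [eLpNorm_eq_lintegral_rpow_enorm_toReal hp hqt, enorm_eq_self, one_div] at h
    rw [ENNReal.rpow_lt_top_iff_of_pos (by positivity)] at h
    filter_upwards [ae_lt_top (hF.pow_const _) h.ne] with x hx
    rwa [ENNReal.rpow_lt_top_iff_of_pos hqr] at hx

theorem auxE_time {d : ℕ} {ε α T : ℝ} (hε : 0 < ε) (hα : 0 < α) {p q : ℝ≥0∞} (hp : p ≠ 0)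
    (f : ℝ → (Fin d → ℝ) → ℝ) :
    eLpNorm (fun t => auxE ε q (f t)) p (volume.restrict (Set.Ioo 0 T))
      ≤ ENNReal.ofReal (ε ^ α) * LpHomBesovNorm T p α q f := by
  rw [LpHomBesovNorm, aux_timeLpOn_eq _ hp]
  refine le_trans ?_ (aux_const_mul hp ENNReal.ofReal_ne_top _)
  exact eLpNorm_mono_enorm fun t => by simpa using auxE_le hε hα q (f t)

end helpers

/-- **Remark 2.4** (Constantin–E–Titi-type commutator estimate, spatial version):
`‖(fg)^ε - f^ε g^ε‖_{L^p(0,T;L^q)} ≤ C ε^{α₁+α₂}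
‖f‖_{L^{p₁}(Ḃ^{α₁}_{q₁,∞})} ‖g‖_{L^{p₂}(Ḃ^{α₂}_{q₂,∞})}`, where the mollification is
taken in the space variable only. -/
theorem constantin_e_titi_commutator_spatial
    (d : ℕ) (hd : 2 ≤ d) (T : ℝ) (hT : 0 < T)
    (α₁ α₂ : ℝ) (hα₁ : 0 < α₁) (hα₁' : α₁ < 1) (hα₂ : 0 < α₂) (hα₂' : α₂ < 1)
    (p q p₁ q₁ p₂ q₂ : ℝ≥0∞)
    (hp : 1 ≤ p) (hq : 1 ≤ q) (hp₁ : 1 ≤ p₁) (hq₁ : 1 ≤ q₁) (hp₂ : 1 ≤ p₂) (hq₂ : 1 ≤ q₂)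
    (hpp : 1 / p = 1 / p₁ + 1 / p₂) (hqq : 1 / q = 1 / q₁ + 1 / q₂) :
    ∃ C : ℝ≥0∞, C < ∞ ∧
      ∀ (f g : ℝ → (Fin d → ℝ) → ℝ) (ε : ℝ), 0 < ε →
        Measurable (Function.uncurry f) → Measurable (Function.uncurry g) →
        (∀ t, SpacePeriodic (f t)) → (∀ t, SpacePeriodic (g t)) →
        LpHomBesovNorm T p₁ α₁ q₁ f < ∞ → LpHomBesovNorm T p₂ α₂ q₂ g < ∞ →
        timeLpOn (Set.Ioo 0 T) p (fun t =>
          eLpNorm (fun x =>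
            sMollify ε (fun y => f t y * g t y) x
              - sMollify ε (f t) x * sMollify ε (g t) x) q (cubeVol d))
          ≤ C * ENNReal.ofReal (ε ^ (α₁ + α₂))
              * LpHomBesovNorm T p₁ α₁ q₁ f * LpHomBesovNorm T p₂ α₂ q₂ g := by
  have hp0 : p ≠ 0 := (zero_lt_one.trans_le hp).ne'
  have hp₁0 : p₁ ≠ 0 := (zero_lt_one.trans_le hp₁).ne'
  have hp₂0 : p₂ ≠ 0 := (zero_lt_one.trans_le hp₂).ne'
  have hq₁0 : q₁ ≠ 0 := (zero_lt_one.trans_le hq₁).ne'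
  have hq₂0 : q₂ ≠ 0 := (zero_lt_one.trans_le hq₂).ne'
  refine ⟨2, by finiteness, ?_⟩
  intro f g ε hε hf hg _ _ hfn hgn
  have mf := auxE_measurable hε hq₁0 hf
  have mg := auxE_measurable hε hq₂0 hg
  have tf := auxE_time (T := T) (q := q₁) hε hα₁ hp₁0 f
  have tg := auxE_time (T := T) (q := q₂) hε hα₂ hp₂0 g
  have ff := aux_ae_fin hp₁0 mf (tf.trans_lt (ENNReal.mul_lt_top ENNReal.ofReal_lt_top hfn))
  have fg := aux_ae_fin hp₂0 mg (tg.trans_lt (ENNReal.mul_lt_top ENNReal.ofReal_lt_top hgn))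
  rw [aux_timeLpOn_eq _ hp0]
  set μ := (volume : Measure ℝ).restrict (Set.Ioo 0 T)
  calc eLpNorm (fun t =>
          eLpNorm (fun x =>
            sMollify ε (fun y => f t y * g t y) x
              - sMollify ε (f t) x * sMollify ε (g t) x) q (cubeVol d)) p μ
      ≤ eLpNorm (fun t => 2 * (auxE ε q₁ (f t) * auxE ε q₂ (g t))) p μ := by
        apply eLpNorm_mono_enorm_ae
        filter_upwards [ff, fg] with t h1 h2
        simp only [enorm_eq_self]
        exact aux_space hε (hf.comp measurable_prodMk_left) (hg.comp measurable_prodMk_left)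
          hq hq₁ hq₂ hqq h1 h2
    _ ≤ 2 * eLpNorm (fun t => auxE ε q₁ (f t) * auxE ε q₂ (g t)) p μ :=
        aux_const_mul hp0 (by finiteness) _
    _ ≤ 2 * (eLpNorm (fun t => auxE ε q₁ (f t)) p₁ μ * eLpNorm (fun t => auxE ε q₂ (g t)) p₂ μ) := by
        gcongr
        exact aux_holder mf.aemeasurable mg.aemeasurable hp₁0 hp₂0 hpp
    _ ≤ 2 * ((ENNReal.ofReal (ε ^ α₁) * LpHomBesovNorm T p₁ α₁ q₁ f)
          * (ENNReal.ofReal (ε ^ α₂) * LpHomBesovNorm T p₂ α₂ q₂ g)) := by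
        gcongr
    _ = 2 * ENNReal.ofReal (ε ^ (α₁ + α₂))
              * LpHomBesovNorm T p₁ α₁ q₁ f * LpHomBesovNorm T p₂ α₂ q₂ g := by
        rw [Real.rpow_add hε, ENNReal.ofReal_mul (by positivity)]
        ring

end CompressibleEuler
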